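/- arXiv:2009.03251 — 5 statements merged into one kernel-verified Lean document; each statement's English description precedes it below -/
import Mathlib

section
/- Let d ≥ 1 and let α, β ∈ ℝ satisfy α + β > d, and fix a comparability constant K ≥ 1. Then there exists a constant C > 0 such that for every n ∈ ℤ^d one has Σ_{n₁} ⟨n₁⟩^{−α} ⟨n − n₁⟩^{−β} ≤ C ⟨n⟩^{d − α − β}, where the sum runs over all n₁ ∈ ℤ^d satisfying K^{−1} ‖n − n₁‖ ≤ ‖n₁‖ ≤ K ‖n − n₁‖. (In contrast with the non-resonant case, no upper restriction α < d is needed here.) -/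
noncomputable section

/-- Japanese bracket `⟨n⟩ = (1 + ‖n‖²)^{1/2}` of a lattice point `n ∈ ℤ^d`. -/
def jb {d : ℕ} (n : Fin d → ℤ) : ℝ :=
  Real.sqrt (1 + ∑ i, ((n i : ℝ)) ^ 2)

/-- Euclidean norm `‖n‖` of a lattice point `n ∈ ℤ^d`. -/
def latNorm {d : ℕ} (n : Fin d → ℤ) : ℝ :=
  Real.sqrt (∑ i, ((n i : ℝ)) ^ 2)

lemma latNorm_eq_norm {d : ℕ} (n : Fin d → ℤ) :
    latNorm n = ‖WithLp.toLp 2 (fun i => (n i : ℝ))‖ := by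
  simp [latNorm, EuclideanSpace.norm_eq]

lemma latNorm_nonneg {d : ℕ} (n : Fin d → ℤ) : 0 ≤ latNorm n :=
  Real.sqrt_nonneg _

lemma latNorm_le_add_sub {d : ℕ} (n m : Fin d → ℤ) :
    latNorm n ≤ latNorm m + latNorm (n - m) := by
  simp only [latNorm_eq_norm]
  refine le_trans (le_of_eq ?_) (norm_add_le _ _)
  congr 1
  ext i
  simp

lemma jb_eq_sqrt_latNorm {d : ℕ} (n : Fin d → ℤ) : jb n = Real.sqrt (1 + latNorm n ^ 2) := by
  rw [jb, latNorm, Real.sq_sqrt (Finset.sum_nonneg fun i _ => sq_nonneg _)]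

lemma one_le_jb {d : ℕ} (n : Fin d → ℤ) : 1 ≤ jb n := by
  rw [jb_eq_sqrt_latNorm]
  exact Real.one_le_sqrt.2 (le_add_of_nonneg_right (sq_nonneg _))

lemma jb_pos {d : ℕ} (n : Fin d → ℤ) : 0 < jb n :=
  zero_lt_one.trans_le (one_le_jb n)

lemma abs_coord_le_jb {d : ℕ} (n : Fin d → ℤ) (i : Fin d) : |(n i : ℝ)| ≤ jb n := by
  refine Real.abs_le_sqrt ?_
  have := Finset.single_le_sum (f := fun i => (n i : ℝ) ^ 2) (fun i _ => sq_nonneg _)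
    (Finset.mem_univ i)
  linarith

lemma jb_le_mul_jb {d : ℕ} {x y : Fin d → ℤ} {K : ℝ} (hK : 1 ≤ K)
    (h : latNorm x ≤ K * latNorm y) : jb x ≤ K * jb y := by
  have hK0 : 0 ≤ K := zero_le_one.trans hK
  rw [jb_eq_sqrt_latNorm, jb_eq_sqrt_latNorm]
  refine Real.sqrt_le_iff.2 ⟨by positivity, ?_⟩
  rw [mul_pow, Real.sq_sqrt (by positivity)]
  have h1 : latNorm x ^ 2 ≤ (K * latNorm y) ^ 2 := pow_le_pow_left₀ (latNorm_nonneg x) h 2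
  nlinarith [one_le_pow₀ hK (n := 2)]

/-- Comparable positive numbers have comparable real powers. -/
lemma rpow_le_of_comparable {a b K : ℝ} (γ : ℝ) (ha : 0 < a) (hb : 0 < b) (hK : 0 < K)
    (hab : a ≤ K * b) (hba : b ≤ K * a) : b ^ γ ≤ K ^ |γ| * a ^ γ := by
  rcases le_total 0 γ with h | h
  · rw [abs_of_nonneg h, ← Real.mul_rpow hK.le ha.le]
    exact Real.rpow_le_rpow hb.le hba h
  · rw [abs_of_nonpos h, Real.rpow_neg hK.le, ← Real.inv_rpow hK.le,
      ← Real.mul_rpow (inv_nonneg.2 hK.le) ha.le]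
    exact Real.rpow_le_rpow_of_nonpos (by positivity) ((inv_mul_le_iff₀ hK).2 hab) h

/-- A finite set of lattice points of bracket less than `T` has at most `(3 T)^d` elements. -/
lemma card_le_of_jb_lt {d : ℕ} (u : Finset (Fin d → ℤ)) {T : ℝ} (hT : 0 < T)
    (hu : ∀ m ∈ u, jb m < T) : (u.card : ℝ) ≤ (3 * T) ^ d := by
  rcases u.eq_empty_or_nonempty with rfl | ⟨m₀, hm₀⟩
  · simp only [Finset.card_empty, Nat.cast_zero]
    positivity
  have hT1 : 1 ≤ T := (one_le_jb m₀).trans (hu m₀ hm₀).le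
  have hsub : u ⊆ Fintype.piFinset fun _ : Fin d => Finset.Icc (-⌊T⌋) ⌊T⌋ := by
    intro m hm
    simp only [Fintype.mem_piFinset, Finset.mem_Icc]
    intro i
    have h := abs_le.1 ((abs_coord_le_jb m i).trans (hu m hm).le)
    refine ⟨neg_le.1 (Int.le_floor.2 ?_), Int.le_floor.2 h.2⟩
    push_cast
    linarith [h.1]
  have hfl : (0 : ℤ) ≤ ⌊T⌋ := Int.floor_nonneg.2 hT.le
  have hcard : ((Finset.Icc (-⌊T⌋) ⌊T⌋).card : ℝ) ≤ 3 * T := by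
    have h : ((Finset.Icc (-⌊T⌋) ⌊T⌋).card : ℤ) = 2 * ⌊T⌋ + 1 := by
      rw [Int.card_Icc]
      omega
    have h' : ((Finset.Icc (-⌊T⌋) ⌊T⌋).card : ℝ) = 2 * ⌊T⌋ + 1 := by exact_mod_cast h
    linarith [Int.floor_le T]
  calc (u.card : ℝ) ≤ ((Fintype.piFinset fun _ : Fin d => Finset.Icc (-⌊T⌋) ⌊T⌋).card : ℝ) := by
        exact_mod_cast Finset.card_le_card hsub
    _ = ((Finset.Icc (-⌊T⌋) ⌊T⌋).card : ℝ) ^ d := by simp [Fintype.card_piFinset]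
    _ ≤ (3 * T) ^ d := pow_le_pow_left₀ (Nat.cast_nonneg _) hcard d

/-- Tail bound for `∑ ⟨m⟩^{-s}` with `s > d`, by dyadic decomposition. -/
lemma sum_jb_rpow_tail_le {d : ℕ} {s R : ℝ} (hs : (d : ℝ) < s) (hR : 0 < R)
    (u : Finset (Fin d → ℤ)) (hu : ∀ m ∈ u, R ≤ jb m) :
    ∑ m ∈ u, jb m ^ (-s) ≤ 6 ^ d * (1 - (2 : ℝ) ^ ((d : ℝ) - s))⁻¹ * R ^ ((d : ℝ) - s) := by
  set q : ℝ := (2 : ℝ) ^ ((d : ℝ) - s) with hq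
  have hq0 : 0 < q := by positivity
  have hq1 : q < 1 := Real.rpow_lt_one_of_one_lt_of_neg one_lt_two (by linarith)
  have hs0 : -s ≤ 0 := by linarith [(Nat.cast_nonneg d : (0 : ℝ) ≤ d)]
  have hex : ∀ m : Fin d → ℤ, ∃ k : ℕ, m ∈ u → 2 ^ k * R ≤ jb m ∧ jb m < 2 ^ (k + 1) * R := by
    intro m
    by_cases hm : m ∈ u
    · obtain ⟨k, h1, h2⟩ := exists_nat_pow_near ((one_le_div hR).2 (hu m hm)) (one_lt_two (α := ℝ))
      exact ⟨k, fun _ => ⟨(le_div_iff₀ hR).1 h1, (div_lt_iff₀ hR).1 h2⟩⟩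
    · exact ⟨0, fun h => absurd h hm⟩
  choose k hk using hex
  have hshell : ∀ j : ℕ, ∑ m ∈ u with k m = j, jb m ^ (-s) ≤
      6 ^ d * R ^ ((d : ℝ) - s) * q ^ j := by
    intro j
    have hpos : (0 : ℝ) < 2 ^ j * R := by positivity
    calc ∑ m ∈ u with k m = j, jb m ^ (-s)
        ≤ ∑ m ∈ u with k m = j, (2 ^ j * R) ^ (-s) := by
          refine Finset.sum_le_sum fun m hm => ?_
          obtain ⟨hmu, rfl⟩ := Finset.mem_filter.1 hm
          exact Real.rpow_le_rpow_of_nonpos hpos (hk m hmu).1 hs0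
      _ = ((u.filter fun m => k m = j).card : ℝ) * (2 ^ j * R) ^ (-s) := by
          rw [Finset.sum_const, nsmul_eq_mul]
      _ ≤ (3 * (2 ^ (j + 1) * R)) ^ d * (2 ^ j * R) ^ (-s) := by
          refine mul_le_mul_of_nonneg_right (card_le_of_jb_lt _ (by positivity) ?_) (by positivity)
          intro m hm
          obtain ⟨hmu, rfl⟩ := Finset.mem_filter.1 hm
          exact (hk m hmu).2
      _ = 6 ^ d * (2 ^ j * R) ^ ((d : ℝ) - s) := by
          rw [show 3 * (2 ^ (j + 1) * R) = 6 * (2 ^ j * R) by ring, mul_pow, mul_assoc,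
            sub_eq_add_neg, Real.rpow_add hpos, Real.rpow_natCast]
      _ = 6 ^ d * R ^ ((d : ℝ) - s) * q ^ j := by
          rw [Real.mul_rpow (by positivity) hR.le, hq, ← Real.rpow_natCast 2 j,
            ← Real.rpow_mul two_pos.le, mul_comm (j : ℝ), Real.rpow_mul two_pos.le,
            Real.rpow_natCast]
          ring
  calc ∑ m ∈ u, jb m ^ (-s) = ∑ j ∈ u.image k, ∑ m ∈ u with k m = j, jb m ^ (-s) :=
        (Finset.sum_fiberwise_of_maps_to (fun m hm => Finset.mem_image_of_mem k hm) _).symm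
    _ ≤ ∑ j ∈ u.image k, 6 ^ d * R ^ ((d : ℝ) - s) * q ^ j :=
        Finset.sum_le_sum fun j _ => hshell j
    _ = 6 ^ d * R ^ ((d : ℝ) - s) * ∑ j ∈ u.image k, q ^ j := by rw [Finset.mul_sum]
    _ ≤ 6 ^ d * R ^ ((d : ℝ) - s) * (1 - q)⁻¹ := by
        refine mul_le_mul_of_nonneg_left ?_ (by positivity)
        rw [← tsum_geometric_of_lt_one hq0.le hq1]
        exact (summable_geometric_of_lt_one hq0.le hq1).sum_le_tsum _ fun j _ => by positivity
    _ = 6 ^ d * (1 - q)⁻¹ * R ^ ((d : ℝ) - s) := by ring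

theorem discrete_convolution_resonant
    (d : ℕ) (hd : 1 ≤ d) (α β K : ℝ) (hαβ : (d : ℝ) < α + β) (hK : 1 ≤ K) :
    ∃ C : ℝ, 0 < C ∧ ∀ n : Fin d → ℤ, ∃ L : ℝ,
      HasSum (fun n₁ : {m : Fin d → ℤ //
          K⁻¹ * latNorm (n - m) ≤ latNorm m ∧ latNorm m ≤ K * latNorm (n - m)} =>
        jb (n₁ : Fin d → ℤ) ^ (-α) * jb (n - (n₁ : Fin d → ℤ)) ^ (-β)) L ∧
      L ≤ C * jb n ^ ((d : ℝ) - α - β) := by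
  have hK0 : 0 < K := zero_lt_one.trans_le hK
  have hd_lt : (2 : ℝ) ^ ((d : ℝ) - (α + β)) < 1 :=
    Real.rpow_lt_one_of_one_lt_of_neg one_lt_two (by linarith)
  set A : ℝ := 6 ^ d * (1 - (2 : ℝ) ^ ((d : ℝ) - (α + β)))⁻¹ with hA
  have hA0 : 0 < A := mul_pos (by positivity) (inv_pos.2 (by linarith))
  refine ⟨K ^ |-β| * A * ((1 + K) ^ ((d : ℝ) - (α + β)))⁻¹, by positivity, fun n => ?_⟩
  set f := fun n₁ : {m : Fin d → ℤ //
      K⁻¹ * latNorm (n - m) ≤ latNorm m ∧ latNorm m ≤ K * latNorm (n - m)} =>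
    jb (n₁ : Fin d → ℤ) ^ (-α) * jb (n - (n₁ : Fin d → ℤ)) ^ (-β) with hf
  have hf0 : ∀ m, 0 ≤ f m := fun m =>
    mul_nonneg (Real.rpow_nonneg (jb_pos _).le _) (Real.rpow_nonneg (jb_pos _).le _)
  have hnear : ∀ m : {m : Fin d → ℤ //
      K⁻¹ * latNorm (n - m) ≤ latNorm m ∧ latNorm m ≤ K * latNorm (n - m)},
      latNorm (n - m.1) ≤ K * latNorm m.1 := fun m => (inv_mul_le_iff₀ hK0).1 m.2.1
  have hterm : ∀ m, f m ≤ K ^ |-β| * jb m.1 ^ (-(α + β)) := by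
    intro m
    have h := rpow_le_of_comparable (-β) (jb_pos m.1) (jb_pos (n - m.1)) hK0
      (jb_le_mul_jb hK m.2.2) (jb_le_mul_jb hK (hnear m))
    calc f m ≤ jb m.1 ^ (-α) * (K ^ |-β| * jb m.1 ^ (-β)) :=
          mul_le_mul_of_nonneg_left h (Real.rpow_nonneg (jb_pos _).le _)
      _ = K ^ |-β| * jb m.1 ^ (-(α + β)) := by
          rw [neg_add, Real.rpow_add (jb_pos _)]
          ring
  have hfar : ∀ m : {m : Fin d → ℤ //
      K⁻¹ * latNorm (n - m) ≤ latNorm m ∧ latNorm m ≤ K * latNorm (n - m)},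
      jb n / (1 + K) ≤ jb m.1 := by
    intro m
    rw [div_le_iff₀' (by positivity)]
    exact jb_le_mul_jb (by linarith) (by linarith [latNorm_le_add_sub n m.1, hnear m])
  have hsum : ∀ u : Finset _, ∑ m ∈ u, f m ≤
      K ^ |-β| * A * ((1 + K) ^ ((d : ℝ) - (α + β)))⁻¹ * jb n ^ ((d : ℝ) - α - β) := by
    intro u
    have htail := sum_jb_rpow_tail_le hαβ (div_pos (jb_pos n) (by positivity : 0 < 1 + K))
      (u.map (Function.Embedding.subtype _)) (by
        intro m hm
        obtain ⟨m', -, rfl⟩ := Finset.mem_map.1 hm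
        exact hfar m')
    rw [Finset.sum_map, ← hA, Real.div_rpow (jb_pos n).le (by positivity)] at htail
    calc ∑ m ∈ u, f m ≤ ∑ m ∈ u, K ^ |-β| * jb m.1 ^ (-(α + β)) :=
          Finset.sum_le_sum fun m _ => hterm m
      _ = K ^ |-β| * ∑ m ∈ u, jb m.1 ^ (-(α + β)) := by rw [Finset.mul_sum]
      _ ≤ K ^ |-β| * (A * (jb n ^ ((d : ℝ) - (α + β)) / (1 + K) ^ ((d : ℝ) - (α + β)))) :=
          mul_le_mul_of_nonneg_left htail (by positivity)
      _ = _ := by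
          rw [sub_sub (d : ℝ) α β]
          ring
  have hsummable : Summable f := summable_of_sum_le hf0 hsum
  exact ⟨_, hsummable.hasSum, hsummable.tsum_le_of_sum_le hsum⟩

end
end

section
/- Let X be a Polish space and let (μ_n) and (ρ_n) be sequences of Borel probability measures on X converging weakly to probability measures μ and ρ, respectively. Suppose that for every ε > 0 there exist δ(ε) > 0 and η(ε) > 0 with δ(ε) → 0 and η(ε) → 0 as ε → 0⁺, such that the following holds: for every continuous function F : X → ℝ with 0 < inf F ≤ F ≤ 1 which satisfies μ_n({x : F(x) ≤ ε}) ≥ 1 − δ(ε) for all sufficiently large n (i.e., for all n ≥ n₀(F)), one has limsup_{n → ∞} ∫_X F dρ_n ≤ η(ε). Then ρ is absolutely continuous with respect to μ. -/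
open MeasureTheory Filter Topology

theorem absolute_continuity_criterion {X : Type*} [TopologicalSpace X] [PolishSpace X]
    [MeasurableSpace X] [BorelSpace X]
    (μn ρn : ℕ → ProbabilityMeasure X) (μ ρ : ProbabilityMeasure X)
    (hμ : Tendsto μn atTop (𝓝 μ)) (hρ : Tendsto ρn atTop (𝓝 ρ))
    (δ η : ℝ → ℝ)
    (hδpos : ∀ ε : ℝ, 0 < ε → 0 < δ ε) (hηpos : ∀ ε : ℝ, 0 < ε → 0 < η ε)
    (hδlim : Tendsto δ (𝓝[>] (0 : ℝ)) (𝓝 0)) (hηlim : Tendsto η (𝓝[>] (0 : ℝ)) (𝓝 0))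
    (h : ∀ ε : ℝ, 0 < ε → ∀ F : X → ℝ, Continuous F →
      (∃ m : ℝ, 0 < m ∧ ∀ x, m ≤ F x) → (∀ x, F x ≤ 1) →
      (∃ n₀ : ℕ, ∀ n ≥ n₀, 1 - δ ε ≤ ((μn n : Measure X) {x | F x ≤ ε}).toReal) →
      limsup (fun n => ∫ x, F x ∂(ρn n : Measure X)) atTop ≤ η ε) :
    (ρ : Measure X) ≪ (μ : Measure X) := by
  refine Measure.AbsolutelyContinuous.mk fun A hA hμA => ?_
  by_contra hρA
  obtain ⟨K, hKA, hK, hρK⟩ := hA.exists_lt_isClosed_of_ne_top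
    (measure_ne_top (ρ : Measure X) A) (pos_iff_ne_zero.2 hρA)
  have hμK : (μ : Measure X) K = 0 := measure_mono_null hKA hμA
  have hbound : ∀ ε : ℝ, 0 < ε → ε < 1 → (ρ : Measure X).real K ≤ η ε := by
    intro ε hε hε1
    have hd : 0 < min (δ ε) 1 := lt_min (hδpos ε hε) one_pos
    obtain ⟨U, hKU, hU, hμU⟩ := K.exists_isOpen_lt_of_lt (μ := (μ : Measure X))
      (ENNReal.ofReal (min (δ ε) 1)) (by rwa [hμK, ENNReal.ofReal_pos])
    obtain ⟨f, hf0, hf1, hf⟩ := exists_continuous_zero_one_of_isClosed hU.isClosed_compl hK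
      (Set.disjoint_left.2 fun x hx hxK => hx (hKU hxK))
    have hFcont : Continuous fun x => max ε (f x) := by fun_prop
    have hF1 : ∀ x, max ε (f x) ≤ 1 := fun x => max_le hε1.le (hf x).2
    have hF0 : ∀ x, 0 ≤ max ε (f x) := fun x => hε.le.trans (le_max_left _ _)
    have hlim : Tendsto (fun n => ∫ x, max ε (f x) ∂(ρn n : Measure X)) atTop
        (𝓝 (∫ x, max ε (f x) ∂(ρ : Measure X))) :=
      (ProbabilityMeasure.tendsto_iff_forall_integral_tendsto.1 hρ)
        (BoundedContinuousFunction.ofNormedAddCommGroup _ hFcont 1 fun x => by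
          rw [Real.norm_of_nonneg (hF0 x)]; exact hF1 x)
    have hV : IsOpen {x | f x < ε} := isOpen_lt f.continuous continuous_const
    have hμV : ENNReal.ofReal (1 - min (δ ε) 1) < (μ : Measure X) {x | f x < ε} := by
      have hUV : Uᶜ ⊆ {x | f x < ε} := fun x hx => by simpa [hf0 hx] using hε
      refine lt_of_lt_of_le ?_ (measure_mono hUV)
      rw [prob_compl_eq_one_sub hU.measurableSet, ENNReal.ofReal_sub _ hd.le,
        ENNReal.ofReal_one]
      exact (ENNReal.cancel_of_ne (by finiteness)).tsub_lt_tsub_left_of_le (by simp) hμU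
    have hev : ∀ᶠ n in atTop, ENNReal.ofReal (1 - min (δ ε) 1) < (μn n : Measure X) {x | f x < ε} :=
      eventually_lt_of_lt_liminf
        (hμV.trans_le (ProbabilityMeasure.le_liminf_measure_open_of_tendsto hμ hV))
    obtain ⟨n₀, hn₀⟩ := eventually_atTop.1 hev
    have hlimsup := h ε hε _ hFcont ⟨ε, hε, fun x => le_max_left _ _⟩ hF1 ⟨n₀, fun n hn => by
      refine (sub_le_sub_left (min_le_left _ _) 1).trans <| (ENNReal.ofReal_le_iff_le_toReal (measure_ne_top _ _)).1
        ((hn₀ n hn).le.trans (measure_mono ?_))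
      exact fun x (hx : f x < ε) => max_le le_rfl hx.le⟩
    rw [hlim.limsup_eq] at hlimsup
    refine le_trans ?_ hlimsup
    rw [← integral_indicator_one hK.measurableSet]
    refine integral_mono ((integrable_const 1).indicator hK.measurableSet)
      (Integrable.of_bound hFcont.aestronglyMeasurable 1 (ae_of_all _ fun x => by
          rw [Real.norm_of_nonneg (hF0 x)]; exact hF1 x)) fun x => ?_
    by_cases hx : x ∈ K
    · simp [hx, hf1 hx]
    · simpa [hx] using hF0 x
  have hle : (ρ : Measure X).real K ≤ 0 := ge_of_tendsto hηlim <| by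
    filter_upwards [Ioo_mem_nhdsGT (zero_lt_one' ℝ)] with ε hε using hbound ε hε.1 hε.2
  exact hle.not_gt (ENNReal.toReal_pos hρK.ne' (measure_ne_top _ _))
end

section
/- Let G be an additive commutative group with a measurable space structure making addition and negation measurable, equipped with a σ-finite measure μ that is invariant under translations and under negation. Let V, f : G → [0, ∞] be measurable. Then ∫_G ( ∫_G V(x − y) f(y) dμ(y) )² f(x)² dμ(x) ≤ ( ∫_G V dμ ) · ∫_G ( ∫_G V(x − y) f(y)² dμ(y) ) f(x)² dμ(x). In particular, on the torus 𝕋³ with a nonnegative potential V₊, the L²-norm of |Θ|(V₊ ∗ |Θ|) is controlled by V̂₊(0)^{1/2} times the square root of the quartic interaction ∫_{𝕋³} (V₊ ∗ Θ²) Θ² dx. -/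
open MeasureTheory
open scoped ENNReal

theorem ENNReal.two_mul_mul_le_sq_add_sq (a b : ℝ≥0∞) : 2 * (a * b) ≤ a ^ 2 + b ^ 2 := by
  by_cases ha : a = ∞
  · simp [ha]
  by_cases hb : b = ∞
  · simp [hb]
  lift a to NNReal using ha
  lift b to NNReal using hb
  norm_cast
  simpa only [mul_assoc] using two_mul_le_add_sq a b

/-- The Cauchy–Schwarz inequality for a weighted integral of extended nonnegative functions. -/
theorem MeasureTheory.sq_lintegral_mul_le {α : Type*} [MeasurableSpace α] (μ : Measure α)
    {w f : α → ℝ≥0∞} (hw : Measurable w) (hf : Measurable f) :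
    (∫⁻ y, w y * f y ∂μ) ^ 2 ≤ (∫⁻ y, w y ∂μ) * ∫⁻ y, w y * f y ^ 2 ∂μ := by
  have hwf : Measurable fun y ↦ w y * f y := hw.mul hf
  have hwf2 : Measurable fun y ↦ w y * f y ^ 2 := hw.mul (hf.pow_const 2)
  have key : 2 * (∫⁻ y, w y * f y ∂μ) ^ 2 ≤
      2 * ((∫⁻ y, w y ∂μ) * ∫⁻ y, w y * f y ^ 2 ∂μ) := by
    calc 2 * (∫⁻ y, w y * f y ∂μ) ^ 2
        = ∫⁻ y, ∫⁻ z, 2 * ((w y * f y) * (w z * f z)) ∂μ ∂μ := by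
          simp_rw [lintegral_const_mul 2 (hwf.const_mul _), lintegral_const_mul _ hwf]
          rw [lintegral_const_mul 2 (hwf.mul_const _), lintegral_mul_const _ hwf, sq]
      _ ≤ ∫⁻ y, ∫⁻ z, w y * f y ^ 2 * w z + w y * (w z * f z ^ 2) ∂μ ∂μ := by
          gcongr with y z
          calc 2 * ((w y * f y) * (w z * f z)) = w y * w z * (2 * (f y * f z)) := by ring
            _ ≤ w y * w z * (f y ^ 2 + f z ^ 2) := by
                gcongr
                exact ENNReal.two_mul_mul_le_sq_add_sq _ _
            _ = _ := by ring
      _ = 2 * ((∫⁻ y, w y ∂μ) * ∫⁻ y, w y * f y ^ 2 ∂μ) := by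
          simp_rw [lintegral_add_left (hw.const_mul _), lintegral_const_mul _ hw,
            lintegral_const_mul _ hwf2]
          rw [lintegral_add_left (hwf2.mul_const _), lintegral_mul_const _ hwf2,
            lintegral_mul_const _ hw]
          ring
  exact (ENNReal.mul_le_mul_iff_right two_ne_zero ENNReal.ofNat_ne_top).1 key

theorem convolution_quartic_interaction_bound
    {G : Type*} [AddCommGroup G] [MeasurableSpace G]
    [MeasurableAdd₂ G] [MeasurableNeg G]
    (μ : Measure G) [SigmaFinite μ]
    [μ.IsAddLeftInvariant] [μ.IsNegInvariant]
    (V f : G → ℝ≥0∞) (hV : Measurable V) (hf : Measurable f) :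
    ∫⁻ x, (∫⁻ y, V (x - y) * f y ∂μ) ^ 2 * f x ^ 2 ∂μ
      ≤ (∫⁻ z, V z ∂μ) * ∫⁻ x, (∫⁻ y, V (x - y) * f y ^ 2 ∂μ) * f x ^ 2 ∂μ := by
  have hconv : Measurable fun x ↦ ∫⁻ y, V (x - y) * f y ^ 2 ∂μ :=
    Measurable.lintegral_prod_right' (f := fun p : G × G ↦ V (p.1 - p.2) * f p.2 ^ 2)
      (by fun_prop)
  have hquartic : Measurable fun x ↦ (∫⁻ y, V (x - y) * f y ^ 2 ∂μ) * f x ^ 2 :=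
    hconv.mul (hf.pow_const 2)
  rw [← lintegral_const_mul _ hquartic]
  refine lintegral_mono fun x ↦ ?_
  rw [← mul_assoc, ← lintegral_sub_left_eq_self V x]
  exact mul_le_mul_left (sq_lintegral_mul_le μ (by fun_prop) hf) _
end

section
/- Let 0 ≤ a < 3/2. Then there exists a constant C > 0 such that for every function g : ℤ³ → ℂ with Σ_{m ∈ ℤ³} (1 + ‖m‖²)^{(3−2a)/4} |g(m)|² < ∞, one has Σ_{n ∈ ℤ³} (1 + ‖n‖²)^{−a} | Σ_{n₁ + n₂ = n} g(n₁) g(n₂) |² ≤ C ( Σ_{m ∈ ℤ³} (1 + ‖m‖²)^{(3−2a)/4} |g(m)|² )². (This is the Plancherel formulation of the product estimate ‖f²‖_{H^{−a}(𝕋³)} ≲ ‖f‖²_{H^{(3−2a)/4}(𝕋³)} on the three-dimensional torus, with g the sequence of Fourier coefficients of f.) -/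
noncomputable section

open scoped ENNReal

theorem sum_Icc_rpow_neg_le {γ : ℝ} (h0 : 0 ≤ γ) (h1 : γ < 1) (N : ℕ) :
    (1 - γ) * ∑ k ∈ Finset.Icc 1 N, (k : ℝ) ^ (-γ) ≤ (N : ℝ) ^ (1 - γ) := by
  induction N with
  | zero => simp [Real.zero_rpow (by linarith : (1 - γ) ≠ 0)]
  | succ N ih =>
    rw [Finset.sum_Icc_succ_top (by omega), mul_add]
    have hpos : (0 : ℝ) < (N : ℝ) + 1 := by positivity
    have hinv : ((N : ℝ) + 1)⁻¹ ≤ 1 := inv_le_one_of_one_le₀ (by linarith [N.cast_nonneg (α := ℝ)])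
    have hb := rpow_one_add_le_one_add_mul_self (s := -((N : ℝ) + 1)⁻¹) (p := 1 - γ)
      (by linarith) (by linarith) (by linarith)
    have hN : (N : ℝ) = (N + 1) * (1 + -((N : ℝ) + 1)⁻¹) := by field_simp; ring
    have hmul : (N : ℝ) ^ (1 - γ) ≤
        ((N : ℝ) + 1) ^ (1 - γ) * (1 + (1 - γ) * -((N : ℝ) + 1)⁻¹) := by
      conv_lhs => rw [hN]
      rw [Real.mul_rpow hpos.le (by linarith)]
      gcongr
    have hexp : ((N : ℝ) + 1) ^ (-γ) = ((N : ℝ) + 1) ^ (1 - γ) * ((N : ℝ) + 1)⁻¹ := by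
      rw [← Real.rpow_neg_one, ← Real.rpow_add hpos]
      ring_nf
    push_cast
    rw [hexp]
    linarith

theorem sum_Icc_one_add_sq_rpow_neg_le {γ : ℝ} (h0 : 0 ≤ γ) (h1 : γ < 1) {N : ℕ} (hN : 1 ≤ N) :
    ∑ k ∈ Finset.Icc (-(N : ℤ)) N, (1 + (k : ℝ) ^ 2) ^ (-(γ / 2)) ≤
      3 / (1 - γ) * (N : ℝ) ^ (1 - γ) := by
  have hγ : 0 < 1 - γ := by linarith
  have hsplit : ∀ M : ℕ, ∑ k ∈ Finset.Icc (-(M : ℤ)) M, (1 + (k : ℝ) ^ 2) ^ (-(γ / 2)) =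
      1 + 2 * ∑ k ∈ Finset.Icc 1 M, (1 + (k : ℝ) ^ 2) ^ (-(γ / 2)) := by
    intro M
    induction M with
    | zero => simp
    | succ M ih =>
      have hset : Finset.Icc (-((M + 1 : ℕ) : ℤ)) ((M + 1 : ℕ) : ℤ) =
          insert (-((M : ℤ) + 1)) (insert ((M : ℤ) + 1) (Finset.Icc (-(M : ℤ)) M)) := by
        ext x
        simp only [Finset.mem_Icc, Finset.mem_insert]
        push_cast
        omega
      rw [hset, Finset.sum_insert (by simp; omega), Finset.sum_insert (by simp), ih,
        Finset.sum_Icc_succ_top (by omega)]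
      push_cast
      rw [neg_sq]
      ring
  have hle : ∑ k ∈ Finset.Icc 1 N, (1 + (k : ℝ) ^ 2) ^ (-(γ / 2)) ≤
      ∑ k ∈ Finset.Icc 1 N, (k : ℝ) ^ (-γ) := by
    refine Finset.sum_le_sum fun k hk => ?_
    have hk0 : (0 : ℝ) < k := by
      have := (Finset.mem_Icc.1 hk).1
      exact_mod_cast this
    have hsq : (k : ℝ) ^ (-γ) = ((k : ℝ) ^ 2) ^ (-(γ / 2)) := by
      rw [← Real.rpow_natCast, ← Real.rpow_mul hk0.le]
      congr 1
      push_cast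
      ring
    rw [hsq]
    exact Real.rpow_le_rpow_of_nonpos (by positivity) (by linarith) (by linarith)
  have hone : (1 : ℝ) ≤ (N : ℝ) ^ (1 - γ) :=
    Real.one_le_rpow (by exact_mod_cast hN) hγ.le
  rw [hsplit, div_mul_eq_mul_div, le_div_iff₀ hγ]
  nlinarith [sum_Icc_rpow_neg_le h0 h1 N, mul_le_mul_of_nonneg_right hle hγ.le]

theorem exists_tsum_ball_rpow_neg_le {β : ℝ} (h0 : 0 ≤ β) (h1 : β < 3 / 2) :
    ∃ C : ℝ, 0 < C ∧ ∀ Q : ℝ, 1 ≤ Q →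
      ∑' x : Fin 3 → ℤ, (if 1 + ∑ i, (x i : ℝ) ^ 2 ≤ 4 * Q then
        ENNReal.ofReal ((1 + ∑ i, (x i : ℝ) ^ 2) ^ (-β)) else 0) ≤
      ENNReal.ofReal (C * Q ^ (3 / 2 - β)) := by
  have hγ : 0 < 1 - 2 * β / 3 := by linarith
  refine ⟨(3 / (1 - 2 * β / 3) * 2 ^ (1 - 2 * β / 3)) ^ 3, by positivity, fun Q hQ => ?_⟩
  set N : ℕ := ⌊2 * √Q⌋₊ with hNdef
  have hsqrt : 1 ≤ √Q := Real.one_le_sqrt.2 hQ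
  have hN1 : 1 ≤ N := Nat.le_floor (by push_cast; linarith)
  have hNle : (N : ℝ) ≤ 2 * √Q := Nat.floor_le (by positivity)
  set B : Finset (Fin 3 → ℤ) := Fintype.piFinset fun _ => Finset.Icc (-(N : ℤ)) N with hB
  have hsupp : ∀ x ∉ B, (if 1 + ∑ i, (x i : ℝ) ^ 2 ≤ 4 * Q then
      ENNReal.ofReal ((1 + ∑ i, (x i : ℝ) ^ 2) ^ (-β)) else 0) = 0 := by
    intro x hx
    rw [if_neg]
    contrapose! hx
    rw [hB, Fintype.mem_piFinset]
    intro i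
    have hi : (x i : ℝ) ^ 2 ≤ ∑ i, (x i : ℝ) ^ 2 :=
      Finset.single_le_sum (f := fun i => (x i : ℝ) ^ 2) (fun j _ => sq_nonneg _)
        (Finset.mem_univ i)
    have habs : |(x i : ℝ)| ≤ 2 * √Q := by
      refine abs_le_of_sq_le_sq ?_ (by positivity)
      rw [mul_pow, Real.sq_sqrt (by linarith)]
      linarith
    have hnat : (x i).natAbs ≤ N := Nat.le_floor (by rwa [Nat.cast_natAbs, Int.cast_abs])
    rw [Finset.mem_Icc]
    omega
  rw [tsum_eq_sum hsupp]
  calc _ ≤ ∑ x ∈ B, ENNReal.ofReal (∏ i, (1 + (x i : ℝ) ^ 2) ^ (-((2 * β / 3) / 2))) := by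
        refine Finset.sum_le_sum fun x _ => ?_
        split_ifs
        · refine ENNReal.ofReal_le_ofReal ?_
          have hq : (0 : ℝ) < 1 + ∑ i, (x i : ℝ) ^ 2 := by positivity
          calc (1 + ∑ i, (x i : ℝ) ^ 2) ^ (-β)
              = ∏ _i : Fin 3, (1 + ∑ i, (x i : ℝ) ^ 2) ^ (-((2 * β / 3) / 2)) := by
                rw [Finset.prod_const, Finset.card_univ, Fintype.card_fin, ← Real.rpow_natCast,
                  ← Real.rpow_mul hq.le]
                congr 1
                push_cast
                ring
            _ ≤ _ := by
                refine Finset.prod_le_prod (fun i _ => by positivity) fun i _ => ?_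
                refine Real.rpow_le_rpow_of_nonpos (by positivity) ?_ (by linarith)
                have := Finset.single_le_sum (f := fun i => (x i : ℝ) ^ 2)
                  (fun j _ => sq_nonneg _) (Finset.mem_univ i)
                linarith
        · exact zero_le
    _ = ENNReal.ofReal (∑ x ∈ B, ∏ i, (1 + (x i : ℝ) ^ 2) ^ (-((2 * β / 3) / 2))) :=
        (ENNReal.ofReal_sum_of_nonneg fun x _ => by positivity).symm
    _ ≤ _ := by
        refine ENNReal.ofReal_le_ofReal ?_
        rw [hB, Finset.sum_prod_piFinset (Finset.Icc (-(N : ℤ)) N)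
          (fun _ k => (1 + (k : ℝ) ^ 2) ^ (-((2 * β / 3) / 2))), Finset.prod_const,
          Finset.card_univ, Fintype.card_fin]
        have hQpow : (Q : ℝ) ^ (3 / 2 - β) = ((√Q) ^ (1 - 2 * β / 3)) ^ 3 := by
          rw [Real.sqrt_eq_rpow, ← Real.rpow_natCast, ← Real.rpow_mul (by positivity),
            ← Real.rpow_mul (by linarith)]
          congr 1
          push_cast
          ring
        rw [hQpow, ← mul_pow, mul_assoc, ← Real.mul_rpow (by norm_num) (by positivity)]
        gcongr
        refine (sum_Icc_one_add_sq_rpow_neg_le (by linarith) (by linarith) hN1).trans ?_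
        gcongr

theorem ENNReal.sq_tsum_mul_le {ι : Type*} (f g : ι → ℝ≥0∞) :
    (∑' i, f i * g i) ^ 2 ≤ (∑' i, f i ^ 2) * ∑' i, g i ^ 2 := by
  have hroot : ∑' i, f i * g i ≤
      (∑' i, f i ^ 2) ^ (1 / 2 : ℝ) * (∑' i, g i ^ 2) ^ (1 / 2 : ℝ) := by
    rw [ENNReal.tsum_eq_iSup_sum]
    refine iSup_le fun s => ?_
    have h := ENNReal.inner_le_Lp_mul_Lq s f g Real.HolderConjugate.two_two
    simp only [ENNReal.rpow_two] at h
    refine h.trans ?_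
    gcongr <;> exact ENNReal.sum_le_tsum s
  calc _ ≤ _ := pow_le_pow_left' hroot 2
    _ = _ := by
      rw [mul_pow, ← ENNReal.rpow_two, ← ENNReal.rpow_two, ← ENNReal.rpow_mul,
        ← ENNReal.rpow_mul]
      norm_num

theorem Real.rpow_neg_mul_rpow_neg_le_add {x y a t : ℝ} (hx : 0 < x) (hy : 0 < y) (ha : 0 ≤ a)
    (ht : 0 ≤ t) : x ^ (-a) * y ^ (-t) ≤ x ^ (-(a + t)) + y ^ (-(a + t)) := by
  rcases le_total x y with h | h
  · calc x ^ (-a) * y ^ (-t) ≤ x ^ (-a) * x ^ (-t) := by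
          gcongr ?_ * ?_
          exact Real.rpow_le_rpow_of_nonpos hx h (neg_nonpos.2 ht)
      _ = x ^ (-(a + t)) := by rw [← Real.rpow_add hx]; ring_nf
      _ ≤ _ := le_add_of_nonneg_right (by positivity)
  · calc x ^ (-a) * y ^ (-t) ≤ y ^ (-a) * y ^ (-t) := by
          gcongr ?_ * ?_
          exact Real.rpow_le_rpow_of_nonpos hy h (neg_nonpos.2 ha)
      _ = y ^ (-(a + t)) := by rw [← Real.rpow_add hy]; ring_nf
      _ ≤ _ := le_add_of_nonneg_left (by positivity)

/-- The Schur-type bound for the kernel of the product estimate, on the region where the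
frequency `m` is dominated by `p`. -/
theorem exists_tsum_kernel_le {a : ℝ} (ha0 : 0 ≤ a) (ha : a < 3 / 2) :
    ∃ C : ℝ, 0 < C ∧ ∀ p : Fin 3 → ℤ,
      ∑' m : Fin 3 → ℤ, (if 1 + ∑ i, (m i : ℝ) ^ 2 ≤ 1 + ∑ i, (p i : ℝ) ^ 2 then
        ENNReal.ofReal ((1 + ∑ i, (((m + p) i : ℤ) : ℝ) ^ 2) ^ (-a)) *
          ENNReal.ofReal ((1 + ∑ i, (m i : ℝ) ^ 2) ^ (-((3 - 2 * a) / 4))) else 0) ≤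
      ENNReal.ofReal C * ENNReal.ofReal ((1 + ∑ i, (p i : ℝ) ^ 2) ^ ((3 - 2 * a) / 4)) := by
  obtain ⟨C, hC, hball⟩ := exists_tsum_ball_rpow_neg_le (β := a + (3 - 2 * a) / 4)
    (by linarith) (by linarith)
  refine ⟨C + C, by positivity, fun p => ?_⟩
  set Q : ℝ := 1 + ∑ i, (p i : ℝ) ^ 2 with hQ
  have hQ1 : 1 ≤ Q := le_add_of_nonneg_right (by positivity)
  set φ : (Fin 3 → ℤ) → ℝ≥0∞ := fun x => if 1 + ∑ i, (x i : ℝ) ^ 2 ≤ 4 * Q then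
    ENNReal.ofReal ((1 + ∑ i, (x i : ℝ) ^ 2) ^ (-(a + (3 - 2 * a) / 4))) else 0 with hφ
  have hφle : ∑' x, φ x ≤ ENNReal.ofReal (C * Q ^ ((3 - 2 * a) / 4)) := by
    convert hball Q hQ1 using 4
    ring
  calc _ ≤ ∑' m, (φ (m + p) + φ m) := by
        refine ENNReal.tsum_le_tsum fun m => ?_
        split_ifs with hm
        · have hmp : 1 + ∑ i, (((m + p) i : ℤ) : ℝ) ^ 2 ≤ 4 * Q := by
            have hle : ∑ i, (((m + p) i : ℤ) : ℝ) ^ 2 ≤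
                ∑ i, (2 * (m i : ℝ) ^ 2 + 2 * (p i : ℝ) ^ 2) := by
              refine Finset.sum_le_sum fun i _ => ?_
              push_cast [Pi.add_apply]
              nlinarith [sq_nonneg ((m i : ℝ) - p i)]
            rw [Finset.sum_add_distrib, ← Finset.mul_sum, ← Finset.mul_sum] at hle
            linarith
          have hm4 : 1 + ∑ i, (m i : ℝ) ^ 2 ≤ 4 * Q := by linarith
          simp only [hφ]
          rw [if_pos hmp, if_pos hm4, ← ENNReal.ofReal_mul (by positivity),
            ← ENNReal.ofReal_add (by positivity) (by positivity)]
          exact ENNReal.ofReal_le_ofReal (Real.rpow_neg_mul_rpow_neg_le_add (by positivity)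
            (by positivity) ha0 (by linarith))
        · exact zero_le
    _ = ∑' x, φ x + ∑' x, φ x := by
        rw [ENNReal.tsum_add, ← (Equiv.addRight p).tsum_eq φ]
        rfl
    _ ≤ _ := by
        refine (add_le_add hφle hφle).trans_eq ?_
        rw [← ENNReal.ofReal_add (by positivity) (by positivity), ← ENNReal.ofReal_mul
          (by positivity)]
        ring_nf

theorem tsum_mul_sub_le_two_mul {G : Type*} [AddCommGroup G] (q : G → ℝ) (e : G → ℝ≥0∞) (n : G) :
    ∑' m, e m * e (n - m) ≤ 2 * ∑' m, if q m ≤ q (n - m) then e m * e (n - m) else 0 := by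
  set T : G → ℝ≥0∞ := fun m => if q m ≤ q (n - m) then e m * e (n - m) else 0 with hT
  calc _ ≤ ∑' m, (T m + T (n - m)) := by
        refine ENNReal.tsum_le_tsum fun m => ?_
        simp only [hT, sub_sub_cancel]
        rcases le_total (q m) (q (n - m)) with h | h
        · rw [if_pos h]
          exact le_self_add
        · rw [if_pos h, mul_comm (e (n - m))]
          exact le_add_self
    _ = _ := by
        rw [ENNReal.tsum_add, two_mul]
        congr 1
        exact (Equiv.subLeft n).tsum_eq T

theorem exists_tsum_convolution_sq_le {a : ℝ} (ha0 : 0 ≤ a) (ha : a < 3 / 2) :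
    ∃ C : ℝ, 0 < C ∧ ∀ e : (Fin 3 → ℤ) → ℝ≥0∞,
      ∑' n : Fin 3 → ℤ, ENNReal.ofReal ((1 + ∑ i, (n i : ℝ) ^ 2) ^ (-a)) *
        (∑' m, e m * e (n - m)) ^ 2 ≤
      ENNReal.ofReal C * (∑' m : Fin 3 → ℤ,
        ENNReal.ofReal ((1 + ∑ i, (m i : ℝ) ^ 2) ^ ((3 - 2 * a) / 4)) * e m ^ 2) ^ 2 := by
  obtain ⟨C, hC, hker⟩ := exists_tsum_kernel_le ha0 ha
  refine ⟨4 * C, by positivity, fun e => ?_⟩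
  set t : ℝ := (3 - 2 * a) / 4 with ht
  set q : (Fin 3 → ℤ) → ℝ := fun m => 1 + ∑ i, (m i : ℝ) ^ 2 with hq
  have hqpos : ∀ m, 0 < q m := fun m => by simp only [hq]; positivity
  have hker' : ∀ p, ∑' m, (if q m ≤ q p then ENNReal.ofReal (q (m + p) ^ (-a)) *
      ENNReal.ofReal (q m ^ (-t)) else 0) ≤ ENNReal.ofReal C * ENNReal.ofReal (q p ^ t) := hker
  change ∑' n, ENNReal.ofReal (q n ^ (-a)) * (∑' m, e m * e (n - m)) ^ 2 ≤
    ENNReal.ofReal (4 * C) * (∑' m, ENNReal.ofReal (q m ^ t) * e m ^ 2) ^ 2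
  set S : ℝ≥0∞ := ∑' m, ENNReal.ofReal (q m ^ t) * e m ^ 2 with hS
  have hsq : ∀ m (r : ℝ), ENNReal.ofReal (q m ^ (r / 2)) ^ 2 = ENNReal.ofReal (q m ^ r) := by
    intro m r
    rw [← ENNReal.ofReal_pow (Real.rpow_nonneg (hqpos m).le _), ← Real.rpow_mul_natCast
      (hqpos m).le]
    congr 2
    push_cast
    ring
  have hcs : ∀ n, (∑' m, e m * e (n - m)) ^ 2 ≤ 4 * (S * ∑' m,
      if q m ≤ q (n - m) then ENNReal.ofReal (q m ^ (-t)) * e (n - m) ^ 2 else 0) := by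
    intro n
    calc _ ≤ (2 * ∑' m, if q m ≤ q (n - m) then e m * e (n - m) else 0) ^ 2 :=
          pow_le_pow_left' (tsum_mul_sub_le_two_mul q e n) 2
      _ = 4 * (∑' m, (ENNReal.ofReal (q m ^ (t / 2)) * e m) * (if q m ≤ q (n - m) then
            ENNReal.ofReal (q m ^ (-t / 2)) * e (n - m) else 0)) ^ 2 := by
          rw [mul_pow]
          congr 2
          · norm_num
          refine tsum_congr fun m => ?_
          split_ifs
          · rw [mul_mul_mul_comm, ← ENNReal.ofReal_mul (Real.rpow_nonneg (hqpos m).le _),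
              ← Real.rpow_add (hqpos m), show t / 2 + -t / 2 = 0 by ring]
            simp
          · simp
      _ ≤ _ := by
          gcongr
          refine (ENNReal.sq_tsum_mul_le _ _).trans_eq ?_
          simp only [mul_pow, ite_pow, hsq, hS]
          simp
  calc _ ≤ ∑' n, ENNReal.ofReal (q n ^ (-a)) * (4 * (S * ∑' m,
        if q m ≤ q (n - m) then ENNReal.ofReal (q m ^ (-t)) * e (n - m) ^ 2 else 0)) :=
        ENNReal.tsum_le_tsum fun n => mul_le_mul_right (hcs n) _
    _ = 4 * S * ∑' n, ∑' m, (if q m ≤ q (n - m) then ENNReal.ofReal (q n ^ (-a)) *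
        ENNReal.ofReal (q m ^ (-t)) else 0) * e (n - m) ^ 2 := by
        rw [← ENNReal.tsum_mul_left]
        refine tsum_congr fun n => ?_
        rw [← mul_assoc 4 S, mul_left_comm]
        refine congrArg (4 * S * ·) ?_
        rw [← ENNReal.tsum_mul_left]
        refine tsum_congr fun m => ?_
        split_ifs
        · ring
        · simp
    _ = 4 * S * ∑' m, ∑' p, (if q m ≤ q p then ENNReal.ofReal (q (m + p) ^ (-a)) *
        ENNReal.ofReal (q m ^ (-t)) else 0) * e p ^ 2 := by
        rw [ENNReal.tsum_comm]
        congr 1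
        refine tsum_congr fun m => ?_
        rw [← (Equiv.addLeft m).tsum_eq fun n => (if q m ≤ q (n - m) then
          ENNReal.ofReal (q n ^ (-a)) * ENNReal.ofReal (q m ^ (-t)) else 0) * e (n - m) ^ 2]
        simp only [Equiv.coe_addLeft, add_sub_cancel_left]
    _ = 4 * S * ∑' p, (∑' m, if q m ≤ q p then ENNReal.ofReal (q (m + p) ^ (-a)) *
        ENNReal.ofReal (q m ^ (-t)) else 0) * e p ^ 2 := by
        rw [ENNReal.tsum_comm]
        simp only [ENNReal.tsum_mul_right]
    _ ≤ 4 * S * ∑' p, ENNReal.ofReal C * (ENNReal.ofReal (q p ^ t) * e p ^ 2) := by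
        refine mul_le_mul_right (ENNReal.tsum_le_tsum fun p => ?_) _
        rw [← mul_assoc]
        exact mul_le_mul_left (hker' p) _
    _ = _ := by
        rw [ENNReal.tsum_mul_left, ← hS, ENNReal.ofReal_mul (by norm_num)]
        norm_num
        ring

theorem square_product_estimate_fourier (a : ℝ) (ha0 : 0 ≤ a) (ha : a < 3 / 2) :
    ∃ C : ℝ, 0 < C ∧ ∀ g : (Fin 3 → ℤ) → ℂ,
      Summable (fun m : Fin 3 → ℤ =>
        (1 + ∑ i, ((m i : ℝ)) ^ 2) ^ ((3 - 2 * a) / 4) * ‖g m‖ ^ 2) →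
      ∃ L : ℝ,
        HasSum (fun n : Fin 3 → ℤ =>
          (1 + ∑ i, ((n i : ℝ)) ^ 2) ^ (-a) *
            ‖∑' m : Fin 3 → ℤ, g m * g (n - m)‖ ^ 2) L ∧
        L ≤ C * (∑' m : Fin 3 → ℤ,
          (1 + ∑ i, ((m i : ℝ)) ^ 2) ^ ((3 - 2 * a) / 4) * ‖g m‖ ^ 2) ^ 2 := by
  obtain ⟨C, hC, hconv⟩ := exists_tsum_convolution_sq_le ha0 ha
  refine ⟨C, hC, fun g hg => ?_⟩
  set S : ℝ := ∑' m : Fin 3 → ℤ,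
    (1 + ∑ i, ((m i : ℝ)) ^ 2) ^ ((3 - 2 * a) / 4) * ‖g m‖ ^ 2 with hS
  have hS0 : 0 ≤ S := tsum_nonneg fun m => by positivity
  have henorm : ∀ (x : ℝ) (z : ℂ), 0 ≤ x →
      ENNReal.ofReal (x * ‖z‖ ^ 2) = ENNReal.ofReal x * ‖z‖ₑ ^ 2 := by
    intro x z hx
    rw [ENNReal.ofReal_mul hx, ENNReal.ofReal_pow (norm_nonneg z), ofReal_norm]
  have hSe : ∑' m : Fin 3 → ℤ, ENNReal.ofReal ((1 + ∑ i, (m i : ℝ) ^ 2) ^ ((3 - 2 * a) / 4)) *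
      ‖g m‖ₑ ^ 2 = ENNReal.ofReal S := by
    rw [hS, ENNReal.ofReal_tsum_of_nonneg (fun m => by positivity) hg]
    exact tsum_congr fun m => (henorm _ _ (by positivity)).symm
  have hbound : ∑' n : Fin 3 → ℤ, ENNReal.ofReal ((1 + ∑ i, ((n i : ℝ)) ^ 2) ^ (-a) *
      ‖∑' m : Fin 3 → ℤ, g m * g (n - m)‖ ^ 2) ≤ ENNReal.ofReal (C * S ^ 2) := by
    calc _ ≤ ∑' n : Fin 3 → ℤ, ENNReal.ofReal ((1 + ∑ i, (n i : ℝ) ^ 2) ^ (-a)) *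
          (∑' m, ‖g m‖ₑ * ‖g (n - m)‖ₑ) ^ 2 := by
          refine ENNReal.tsum_le_tsum fun n => ?_
          rw [henorm _ _ (by positivity)]
          gcongr
          simpa only [enorm_mul] using enorm_tsum_le_tsum_enorm (f := fun m => g m * g (n - m))
      _ ≤ _ := hconv fun m => ‖g m‖ₑ
      _ = _ := by rw [hSe, ENNReal.ofReal_mul hC.le, ENNReal.ofReal_pow hS0]
  have hfin : ∀ s : Finset (Fin 3 → ℤ), ∑ n ∈ s, (1 + ∑ i, ((n i : ℝ)) ^ 2) ^ (-a) *
      ‖∑' m : Fin 3 → ℤ, g m * g (n - m)‖ ^ 2 ≤ C * S ^ 2 := by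
    intro s
    rw [← ENNReal.ofReal_le_ofReal_iff (by positivity),
      ENNReal.ofReal_sum_of_nonneg fun n _ => by positivity]
    exact (ENNReal.sum_le_tsum s).trans hbound
  have hsum := summable_of_sum_le (fun n => by positivity) hfin
  exact ⟨_, hsum.hasSum, hsum.tsum_le_of_sum_le hfin⟩

end
end

section
/- Let 0 < β ≤ 1/2 and ε > 0. Then there exists a constant C > 0 such that for every t ∈ (0, 1] and every ξ ∈ ℝ³ one has Σ_{k ∈ ℤ³} (1 + ‖k‖²)^{−β/2} e^{−t ‖k − ξ‖²} ≤ C t^{−3/2 − ε} (1 + ‖ξ‖²)^{−β/2}. -/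
/-- Partial sums over a lattice of a product of nonnegative functions of one coordinate each are
bounded by the product of bounds for the one-dimensional partial sums. -/
theorem sum_prod_le_prod_of_sum_le {ι α : Type*} [Fintype ι] [DecidableEq ι] [DecidableEq α]
    {f : ι → α → ℝ} (hf : ∀ i a, 0 ≤ f i a) {M : ι → ℝ}
    (hM : ∀ i (s : Finset α), ∑ a ∈ s, f i a ≤ M i) (s : Finset (ι → α)) :
    ∑ k ∈ s, ∏ i, f i (k i) ≤ ∏ i, M i := by
  calc ∑ k ∈ s, ∏ i, f i (k i)
      ≤ ∑ k ∈ Fintype.piFinset fun i => s.image fun k => k i, ∏ i, f i (k i) := by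
        refine Finset.sum_le_sum_of_subset_of_nonneg (fun k hk => ?_)
          fun k _ _ => Finset.prod_nonneg fun i _ => hf i _
        exact Fintype.mem_piFinset.2 fun i => Finset.mem_image_of_mem _ hk
    _ = ∏ i, ∑ a ∈ s.image fun k => k i, f i a := (Finset.prod_univ_sum _ _).symm
    _ ≤ ∏ i, M i :=
        Finset.prod_le_prod (fun i _ => Finset.sum_nonneg fun a _ => hf i a) fun i _ => hM i _

theorem summable_one_add_int_sq_rpow {q : ℝ} (hq : 1 / 2 < q) :
    Summable fun k : ℤ => (1 + (k : ℝ) ^ 2) ^ (-q) := by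
  have h : Summable fun k : ℤ => |(k : ℝ)| ^ (-(2 * q)) :=
    Real.summable_abs_int_rpow (by linarith)
  refine Summable.of_norm_bounded_eventually h ?_
  filter_upwards [(Set.finite_singleton (0 : ℤ)).compl_mem_cofinite] with k hk
  have hk' : (0 : ℝ) < |(k : ℝ)| := abs_pos.2 (by exact_mod_cast hk)
  rw [Real.norm_of_nonneg (by positivity)]
  calc (1 + (k : ℝ) ^ 2) ^ (-q) ≤ (|(k : ℝ)| ^ 2) ^ (-q) :=
        Real.rpow_le_rpow_of_nonpos (by positivity) (by rw [sq_abs]; linarith) (by linarith)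
    _ = |(k : ℝ)| ^ (-(2 * q)) := by
        rw [← Real.rpow_natCast, ← Real.rpow_mul hk'.le]; push_cast; ring_nf

/-- The sums of `(1 + (k - x)²)^(-q)` over the integers are bounded uniformly in `x`. -/
theorem exists_sum_one_add_int_sub_sq_rpow_le {q : ℝ} (hq : 1 / 2 < q) :
    ∃ M : ℝ, ∀ (x : ℝ) (s : Finset ℤ), ∑ k ∈ s, (1 + ((k : ℝ) - x) ^ 2) ^ (-q) ≤ M := by
  have hs := summable_one_add_int_sq_rpow hq
  refine ⟨3 ^ q * ∑' k : ℤ, (1 + (k : ℝ) ^ 2) ^ (-q), fun x s => ?_⟩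
  have hpt (k : ℤ) : (1 + ((k : ℝ) - x) ^ 2) ^ (-q) ≤
      3 ^ q * (1 + ((k - ⌊x⌋ : ℤ) : ℝ) ^ 2) ^ (-q) := by
    have h0 := Int.floor_le x
    have h1 := Int.lt_floor_add_one x
    have h3 : (3 : ℝ) ^ q = (1 / 3 : ℝ) ^ (-q) := by
      rw [Real.rpow_neg (by norm_num), ← Real.inv_rpow (by norm_num)]; norm_num
    rw [h3, ← Real.mul_rpow (by norm_num) (by positivity)]
    refine Real.rpow_le_rpow_of_nonpos (by positivity) ?_ (by linarith)
    push_cast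
    nlinarith [sq_nonneg ((k : ℝ) - x - (x - ⌊x⌋)),
      mul_nonneg (sub_nonneg.2 h0) (sub_nonneg.2 h1.le)]
  have hs' : Summable fun k : ℤ => (1 + ((k - ⌊x⌋ : ℤ) : ℝ) ^ 2) ^ (-q) :=
    (Equiv.subRight ⌊x⌋).summable_iff.2 hs
  calc ∑ k ∈ s, (1 + ((k : ℝ) - x) ^ 2) ^ (-q)
      ≤ ∑ k ∈ s, 3 ^ q * (1 + ((k - ⌊x⌋ : ℤ) : ℝ) ^ 2) ^ (-q) :=
        Finset.sum_le_sum fun k _ => hpt k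
    _ = 3 ^ q * ∑ k ∈ s, (1 + ((k - ⌊x⌋ : ℤ) : ℝ) ^ 2) ^ (-q) := (Finset.mul_sum _ _ _).symm
    _ ≤ 3 ^ q * ∑' k : ℤ, (1 + ((k - ⌊x⌋ : ℤ) : ℝ) ^ 2) ^ (-q) := by
        gcongr
        exact hs'.sum_le_tsum s fun k _ => by positivity
    _ = 3 ^ q * ∑' k : ℤ, (1 + (k : ℝ) ^ 2) ^ (-q) := by
        rw [← (Equiv.subRight ⌊x⌋).tsum_eq fun k : ℤ => (1 + (k : ℝ) ^ 2) ^ (-q)]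
        rfl

/-- In dimension three, the lattice sums of `(1 + ‖k - ξ‖²)^(-p)` with `p > 3/2` are bounded
uniformly in `ξ`. -/
theorem exists_sum_one_add_lattice_sub_sq_rpow_le {p : ℝ} (hp : 3 / 2 < p) :
    ∃ M : ℝ, ∀ (ξ : Fin 3 → ℝ) (s : Finset (Fin 3 → ℤ)),
      ∑ k ∈ s, (1 + ∑ i, ((k i : ℝ) - ξ i) ^ 2) ^ (-p) ≤ M := by
  obtain ⟨M, hM⟩ := exists_sum_one_add_int_sub_sq_rpow_le (q := p / 3) (by linarith)
  refine ⟨∏ _i : Fin 3, M, fun ξ s => le_trans (Finset.sum_le_sum fun k _ => ?_)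
    (sum_prod_le_prod_of_sum_le (f := fun i (a : ℤ) => (1 + ((a : ℝ) - ξ i) ^ 2) ^ (-(p / 3)))
      (fun i a => by positivity) (fun i => hM (ξ i)) s)⟩
  have hpos : 0 < 1 + ∑ i, ((k i : ℝ) - ξ i) ^ 2 := by positivity
  calc (1 + ∑ i, ((k i : ℝ) - ξ i) ^ 2) ^ (-p)
      = ∏ _j : Fin 3, (1 + ∑ i, ((k i : ℝ) - ξ i) ^ 2) ^ (-(p / 3)) := by
        rw [Finset.prod_const, ← Real.rpow_natCast, ← Real.rpow_mul hpos.le]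
        congr 1
        simp
    _ ≤ ∏ j, (1 + ((k j : ℝ) - ξ j) ^ 2) ^ (-(p / 3)) := by
        refine Finset.prod_le_prod (fun j _ => by positivity) fun j _ => ?_
        refine Real.rpow_le_rpow_of_nonpos (by positivity) ?_ (by linarith)
        gcongr
        exact Finset.single_le_sum (f := fun i => ((k i : ℝ) - ξ i) ^ 2)
          (fun i _ => sq_nonneg _) (Finset.mem_univ j)

theorem exp_neg_le_mul_one_add_rpow {p u : ℝ} (hp : 0 < p) (hu : 0 ≤ u) :
    Real.exp (-u) ≤ p ^ p * Real.exp 1 * (1 + u) ^ (-p) := by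
  have h1 : 1 + u ≤ p * Real.exp ((1 + u) / p) := by
    have := Real.add_one_le_exp ((1 + u) / p)
    calc 1 + u = p * ((1 + u) / p) := by field_simp
      _ ≤ p * Real.exp ((1 + u) / p) := by gcongr; linarith
  have h2 : (1 + u) ^ p ≤ p ^ p * Real.exp (1 + u) := by
    calc (1 + u) ^ p ≤ (p * Real.exp ((1 + u) / p)) ^ p := by gcongr
      _ = p ^ p * Real.exp (1 + u) := by
        rw [Real.mul_rpow hp.le (Real.exp_pos _).le, ← Real.exp_mul]
        congr 2
        field_simp
  rw [Real.rpow_neg (by positivity), ← div_eq_mul_inv, le_div_iff₀ (by positivity)]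
  calc Real.exp (-u) * (1 + u) ^ p ≤ Real.exp (-u) * (p ^ p * Real.exp (1 + u)) := by gcongr
    _ = p ^ p * Real.exp 1 := by
      rw [Real.exp_add, Real.exp_neg]
      field_simp

theorem exp_neg_mul_le_rpow_mul_rpow {p t y : ℝ} (hp : 0 < p) (ht : 0 < t) (ht1 : t ≤ 1)
    (hy : 0 ≤ y) :
    Real.exp (-t * y) ≤ p ^ p * Real.exp 1 * (t ^ (-p) * (1 + y) ^ (-p)) := by
  rw [neg_mul]
  refine (exp_neg_le_mul_one_add_rpow hp (by positivity)).trans ?_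
  gcongr
  rw [← Real.mul_rpow ht.le (by positivity)]
  exact Real.rpow_le_rpow_of_nonpos (by positivity) (by linarith) (by linarith)

/-- A Peetre-type inequality: negative powers of `X ≲ A + B` can be traded for those of `A`, at
the price of exchanging `B^(-p)` for `A^(-p) + B^(-p)`. -/
theorem rpow_neg_mul_rpow_neg_le {b p A B X : ℝ} (hb : 0 ≤ b) (hbp : b ≤ p) (hA : 0 < A)
    (hB : 0 < B) (hX : 0 < X) (h : X ≤ 2 * A + 2 * B) :
    A ^ (-b) * B ^ (-p) ≤ 4 ^ b * X ^ (-b) * (A ^ (-p) + B ^ (-p)) := by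
  have key {Y : ℝ} (hY : X ≤ 4 * Y) : Y ^ (-b) ≤ 4 ^ b * X ^ (-b) := by
    have h4 : (4 : ℝ) ^ b = (1 / 4 : ℝ) ^ (-b) := by
      rw [Real.rpow_neg (by norm_num), ← Real.inv_rpow (by norm_num)]; norm_num
    rw [h4, ← Real.mul_rpow (by norm_num) hX.le]
    exact Real.rpow_le_rpow_of_nonpos (by positivity) (by linarith) (by linarith)
  have hAp : 0 ≤ A ^ (-p) := by positivity
  have hBp : 0 ≤ B ^ (-p) := by positivity
  rcases le_total B A with hBA | hAB
  · calc A ^ (-b) * B ^ (-p) ≤ 4 ^ b * X ^ (-b) * B ^ (-p) := by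
          gcongr
          exact key (by linarith)
      _ ≤ _ := by gcongr; linarith
  · have hswap : B ^ (-(p - b)) ≤ A ^ (-(p - b)) :=
      Real.rpow_le_rpow_of_nonpos hA hAB (by linarith)
    have hsplit {Y : ℝ} (hY : 0 < Y) : Y ^ (-p) = Y ^ (-b) * Y ^ (-(p - b)) := by
      rw [← Real.rpow_add hY]; ring_nf
    calc A ^ (-b) * B ^ (-p) = A ^ (-b) * B ^ (-b) * B ^ (-(p - b)) := by
          rw [hsplit hB, mul_assoc]
      _ ≤ A ^ (-b) * B ^ (-b) * A ^ (-(p - b)) := by gcongr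
      _ = B ^ (-b) * A ^ (-p) := by rw [hsplit hA]; ring
      _ ≤ 4 ^ b * X ^ (-b) * A ^ (-p) := by
          gcongr
          exact key (by linarith)
      _ ≤ _ := by gcongr; linarith

theorem gaussian_weighted_lattice_sum (β ε : ℝ) (hβ0 : 0 < β) (hβ : β ≤ 1 / 2) (hε : 0 < ε) :
    ∃ C : ℝ, 0 < C ∧ ∀ t : ℝ, 0 < t → t ≤ 1 → ∀ ξ : Fin 3 → ℝ, ∃ L : ℝ,
      HasSum (fun k : Fin 3 → ℤ =>
        (1 + ∑ i, ((k i : ℝ)) ^ 2) ^ (-β / 2) *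
          Real.exp (-t * ∑ i, ((k i : ℝ) - ξ i) ^ 2)) L ∧
      L ≤ C * t ^ (-(3 : ℝ) / 2 - ε) * (1 + ∑ i, (ξ i) ^ 2) ^ (-β / 2) := by
  obtain ⟨p, hp⟩ : ∃ p : ℝ, p = 3 / 2 + ε := ⟨_, rfl⟩
  have hp0 : 0 < p := by linarith
  obtain ⟨M, hM⟩ := exists_sum_one_add_lattice_sub_sq_rpow_le (p := p) (by linarith)
  have hM0 : 0 ≤ M := by simpa using hM 0 ∅
  rw [show -(3 : ℝ) / 2 - ε = -p by rw [hp]; ring, show -β / 2 = -(β / 2) by ring]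
  refine ⟨p ^ p * Real.exp 1 * 4 ^ (β / 2) * (2 * M + 1), by positivity,
    fun t ht ht1 ξ => ?_⟩
  have hpt (k : Fin 3 → ℤ) : (1 + ∑ i, ((k i : ℝ)) ^ 2) ^ (-(β / 2)) *
      Real.exp (-t * ∑ i, ((k i : ℝ) - ξ i) ^ 2) ≤
      p ^ p * Real.exp 1 * 4 ^ (β / 2) * t ^ (-p) * (1 + ∑ i, (ξ i) ^ 2) ^ (-(β / 2)) *
        ((1 + ∑ i, ((k i : ℝ)) ^ 2) ^ (-p) + (1 + ∑ i, ((k i : ℝ) - ξ i) ^ 2) ^ (-p)) := by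
    have hX : 1 + ∑ i, (ξ i) ^ 2 ≤
        2 * (1 + ∑ i, ((k i : ℝ)) ^ 2) + 2 * (1 + ∑ i, ((k i : ℝ) - ξ i) ^ 2) := by
      have : ∑ i, (ξ i) ^ 2 ≤ ∑ i, (2 * (k i : ℝ) ^ 2 + 2 * ((k i : ℝ) - ξ i) ^ 2) :=
        Finset.sum_le_sum fun i _ => by nlinarith [sq_nonneg (2 * (k i : ℝ) - ξ i)]
      rw [Finset.sum_add_distrib, ← Finset.mul_sum, ← Finset.mul_sum] at this
      linarith
    have hP := rpow_neg_mul_rpow_neg_le (b := β / 2) (p := p) (by linarith) (by linarith)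
      (by positivity) (by positivity) (by positivity) hX
    calc _ ≤ (1 + ∑ i, ((k i : ℝ)) ^ 2) ^ (-(β / 2)) * (p ^ p * Real.exp 1 *
            (t ^ (-p) * (1 + ∑ i, ((k i : ℝ) - ξ i) ^ 2) ^ (-p))) := by
          gcongr
          exact exp_neg_mul_le_rpow_mul_rpow hp0 ht ht1 (by positivity)
      _ = p ^ p * Real.exp 1 * t ^ (-p) * ((1 + ∑ i, ((k i : ℝ)) ^ 2) ^ (-(β / 2)) *
            (1 + ∑ i, ((k i : ℝ) - ξ i) ^ 2) ^ (-p)) := by ring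
      _ ≤ p ^ p * Real.exp 1 * t ^ (-p) * _ := mul_le_mul_of_nonneg_left hP (by positivity)
      _ = _ := by ring
  have hsum (s : Finset (Fin 3 → ℤ)) : ∑ k ∈ s, (1 + ∑ i, ((k i : ℝ)) ^ 2) ^ (-(β / 2)) *
      Real.exp (-t * ∑ i, ((k i : ℝ) - ξ i) ^ 2) ≤
      p ^ p * Real.exp 1 * 4 ^ (β / 2) * (2 * M + 1) * t ^ (-p) *
        (1 + ∑ i, (ξ i) ^ 2) ^ (-(β / 2)) := by
    have h0 : ∑ k ∈ s, (1 + ∑ i, ((k i : ℝ)) ^ 2) ^ (-p) ≤ M := by simpa using hM 0 s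
    calc _ ≤ _ := Finset.sum_le_sum fun k _ => hpt k
      _ = p ^ p * Real.exp 1 * 4 ^ (β / 2) * t ^ (-p) * (1 + ∑ i, (ξ i) ^ 2) ^ (-(β / 2)) *
          (∑ k ∈ s, (1 + ∑ i, ((k i : ℝ)) ^ 2) ^ (-p) +
            ∑ k ∈ s, (1 + ∑ i, ((k i : ℝ) - ξ i) ^ 2) ^ (-p)) := by
          rw [← Finset.mul_sum, Finset.sum_add_distrib]
      _ ≤ p ^ p * Real.exp 1 * 4 ^ (β / 2) * t ^ (-p) * (1 + ∑ i, (ξ i) ^ 2) ^ (-(β / 2)) *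
          (2 * M + 1) := by
          refine mul_le_mul_of_nonneg_left ?_ (by positivity)
          linarith [hM ξ s]
      _ = _ := by ring
  have hs := summable_of_sum_le (fun k => by positivity) hsum
  exact ⟨_, hs.hasSum, hs.tsum_le_of_sum_le hsum⟩
end
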